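/- arXiv:1310.2860 — 5 statements merged into one kernel-verified Lean document; each statement's English description precedes it below -/
import Mathlib

section
/- Let M be a positive integer, p_1,…,p_M ∈ [0,1], and let X_1,…,X_M be independent random variables with X_i ∼ Bernoulli(p_i). Then the Shannon entropy (in bits) of their sum satisfies H(∑_{i=1}^M X_i) ≤ (1/2)·log₂( 2πe·( ∑_{i=1}^M p_i + 1/12 ) ). -/
open MeasureTheory ProbabilityTheory

/-- Shannon entropy (in bits) of a random variable `X` with respect to the measure `μ`:
`H(X) = -∑ₐ P(X = a) log₂ P(X = a)`, with the convention `0 · log₂ 0 = 0` (automatic, since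
`Real.logb 2 0 = 0`). -/
noncomputable def shannonEntropy {Ω α : Type*} [MeasurableSpace Ω]
    (μ : Measure Ω) (X : Ω → α) : ℝ :=
  ∑' a : α, -((μ (X ⁻¹' {a})).toReal * Real.logb 2 (μ (X ⁻¹' {a})).toReal)

/-- Jensen's inequality on a unit cell: the exponential of the average of a Gaussian exponent
over `[a - 1/2, a + 1/2]` is at most the Gaussian integral over that cell. -/
theorem exp_neg_sq_add_le_integral_cell (a m v : ℝ) :
    Real.exp (-((a - m) ^ 2 + 1 / 12) / (2 * v))
      ≤ ∫ x in (a - 1 / 2)..(a + 1 / 2), Real.exp (-(x - m) ^ 2 / (2 * v)) := by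
  set c : ℝ := -((a - m) ^ 2 + 1 / 12) / (2 * v) with hc
  have hsq : ∫ x in (a - 1 / 2)..(a + 1 / 2), (x - m) ^ 2 = (a - m) ^ 2 + 1 / 12 := by
    rw [intervalIntegral.integral_comp_sub_right (fun x => x ^ 2) m, integral_pow]
    norm_num
    ring
  have htangent : ∫ x in (a - 1 / 2)..(a + 1 / 2),
      Real.exp c * (-(1 / (2 * v)) * (x - m) ^ 2 + (1 - c)) = Real.exp c := by
    rw [intervalIntegral.integral_const_mul, intervalIntegral.integral_add
      (Continuous.intervalIntegrable (by fun_prop) _ _)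
      (Continuous.intervalIntegrable (by fun_prop) _ _),
      intervalIntegral.integral_const_mul, hsq, intervalIntegral.integral_const, hc]
    simp only [smul_eq_mul]
    ring
  rw [← htangent]
  refine intervalIntegral.integral_mono_on (by linarith)
    (Continuous.intervalIntegrable (by fun_prop) _ _)
    (Continuous.intervalIntegrable (by fun_prop) _ _) fun x _ => ?_
  have h := Real.add_one_le_exp (-(x - m) ^ 2 / (2 * v) - c)
  calc Real.exp c * (-(1 / (2 * v)) * (x - m) ^ 2 + (1 - c))
      = Real.exp c * (-(x - m) ^ 2 / (2 * v) - c + 1) := by ring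
    _ ≤ Real.exp c * Real.exp (-(x - m) ^ 2 / (2 * v) - c) := by gcongr
    _ = Real.exp (-(x - m) ^ 2 / (2 * v)) := by rw [← Real.exp_add]; ring_nf

theorem sum_exp_neg_sq_add_le_sqrt (n : ℕ) (m : ℝ) {v : ℝ} (hv : 0 < v) :
    ∑ k ∈ Finset.range n, Real.exp (-(((k : ℝ) - m) ^ 2 + 1 / 12) / (2 * v))
      ≤ √(2 * Real.pi * v) := by
  lift v to NNReal using hv.le
  have hpdf (x : ℝ) : Real.exp (-(x - m) ^ 2 / (2 * v))
      = √(2 * Real.pi * v) * gaussianPDFReal m v x := by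
    have : √(2 * Real.pi * v) ≠ 0 := by positivity
    rw [gaussianPDFReal, mul_inv_cancel_left₀ this]
  have hint : Integrable (fun x : ℝ => Real.exp (-(x - m) ^ 2 / (2 * v))) := by
    simp_rw [hpdf]
    exact (integrable_gaussianPDFReal _ _).const_mul _
  have htotal : ∫ x : ℝ, Real.exp (-(x - m) ^ 2 / (2 * v)) = √(2 * Real.pi * v) := by
    simp_rw [hpdf]
    rw [integral_const_mul, integral_gaussianPDFReal_eq_one, mul_one]
    exact_mod_cast hv.ne'
  have hcells := intervalIntegral.sum_integral_adjacent_intervals (n := n) (μ := volume)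
    (a := fun k : ℕ => (k : ℝ) - 1 / 2) (f := fun x : ℝ => Real.exp (-(x - m) ^ 2 / (2 * v)))
    fun k _ => hint.intervalIntegrable
  calc ∑ k ∈ Finset.range n, Real.exp (-(((k : ℝ) - m) ^ 2 + 1 / 12) / (2 * v))
      ≤ ∑ k ∈ Finset.range n, ∫ x in ((k : ℝ) - 1 / 2)..((k + 1 : ℕ) - 1 / 2 : ℝ),
          Real.exp (-(x - m) ^ 2 / (2 * v)) := by
        refine Finset.sum_le_sum fun k _ => ?_
        rw [show ((k + 1 : ℕ) - 1 / 2 : ℝ) = k + 1 / 2 by push_cast; ring]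
        exact exp_neg_sq_add_le_integral_cell k m v
    _ = ∫ x in (((0 : ℕ) : ℝ) - 1 / 2)..((n : ℝ) - 1 / 2),
          Real.exp (-(x - m) ^ 2 / (2 * v)) := hcells
    _ ≤ ∫ x : ℝ, Real.exp (-(x - m) ^ 2 / (2 * v)) := by
        rw [intervalIntegral.integral_of_le (by push_cast; linarith [n.cast_nonneg (α := ℝ)])]
        exact setIntegral_le_integral hint (ae_of_all _ fun x => (Real.exp_pos _).le)
    _ = √(2 * Real.pi * v) := htotal

/-- Gibbs' inequality, termwise. -/
theorem neg_mul_log_le_neg_mul_log_add {q r : ℝ} (hq : 0 ≤ q) (hr : 0 < r) :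
    -(q * Real.log q) ≤ -(q * Real.log r) + (r - q) := by
  rcases hq.eq_or_lt with rfl | hq
  · simpa using hr.le
  · have h := mul_le_mul_of_nonneg_left (Real.log_le_sub_one_of_pos (div_pos hr hq)) hq.le
    rw [Real.log_div hr.ne' hq.ne', mul_sub, mul_sub, mul_div_cancel₀ _ hq.ne'] at h
    linarith

/-- A distribution on the integers with second moment about `m` at most `v - 1/12` has entropy
(in nats) at most that of a Gaussian of variance `v`. -/
theorem sum_neg_mul_log_le_gaussian (n : ℕ) (q : ℕ → ℝ) (m : ℝ) {v : ℝ} (hv : 0 < v)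
    (hq : ∀ k, 0 ≤ q k) (hsum : ∑ k ∈ Finset.range n, q k = 1)
    (hvar : ∑ k ∈ Finset.range n, q k * ((k : ℝ) - m) ^ 2 + 1 / 12 ≤ v) :
    ∑ k ∈ Finset.range n, -(q k * Real.log (q k))
      ≤ 1 / 2 * Real.log (2 * Real.pi * Real.exp 1 * v) := by
  set s := √(2 * Real.pi * v) with hs
  have hs0 : 0 < s := by positivity
  set r : ℕ → ℝ := fun k => Real.exp (-(((k : ℝ) - m) ^ 2 + 1 / 12) / (2 * v)) / s with hr
  have hr1 : ∑ k ∈ Finset.range n, r k ≤ 1 := by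
    rw [← Finset.sum_div, div_le_one hs0]
    exact sum_exp_neg_sq_add_le_sqrt n m hv
  have hlogr (k : ℕ) : -(q k * Real.log (r k))
      = (Real.log s + 1 / 12 / (2 * v)) * q k + 1 / (2 * v) * (q k * ((k : ℝ) - m) ^ 2) := by
    rw [hr, Real.log_div (Real.exp_pos _).ne' hs0.ne', Real.log_exp]
    ring
  have hlogs : 1 / 2 * Real.log (2 * Real.pi * Real.exp 1 * v) = Real.log s + 1 / 2 := by
    rw [hs, Real.log_sqrt (by positivity),
      show 2 * Real.pi * Real.exp 1 * v = (2 * Real.pi * v) * Real.exp 1 by ring,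
      Real.log_mul (by positivity) (by positivity), Real.log_exp]
    ring
  have hmoment : 1 / (2 * v) * (∑ k ∈ Finset.range n, q k * ((k : ℝ) - m) ^ 2 + 1 / 12)
      ≤ 1 / 2 := by
    calc _ ≤ 1 / (2 * v) * v := by gcongr
      _ = 1 / 2 := by field_simp
  calc ∑ k ∈ Finset.range n, -(q k * Real.log (q k))
      ≤ ∑ k ∈ Finset.range n, (-(q k * Real.log (r k)) + (r k - q k)) :=
        Finset.sum_le_sum fun k _ => neg_mul_log_le_neg_mul_log_add (hq k) (by positivity)
    _ = Real.log s
          + 1 / (2 * v) * (∑ k ∈ Finset.range n, q k * ((k : ℝ) - m) ^ 2 + 1 / 12)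
          + (∑ k ∈ Finset.range n, r k - 1) := by
        simp_rw [hlogr]
        rw [Finset.sum_add_distrib, Finset.sum_add_distrib, Finset.sum_sub_distrib,
          ← Finset.mul_sum, ← Finset.mul_sum, hsum]
        ring
    _ ≤ 1 / 2 * Real.log (2 * Real.pi * Real.exp 1 * v) := by linarith

theorem integral_comp_eq_sum_range {Ω : Type*} [MeasurableSpace Ω] (μ : Measure Ω)
    [IsFiniteMeasure μ] {S : Ω → ℕ} (hS : Measurable S) {n : ℕ} (hn : ∀ ω, S ω < n)
    (g : ℕ → ℝ) :
    ∫ ω, g (S ω) ∂μ = ∑ k ∈ Finset.range n, (μ (S ⁻¹' {k})).toReal * g k := by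
  have hms (k : ℕ) : MeasurableSet (S ⁻¹' {k}) := hS (measurableSet_singleton k)
  have hpt (ω : Ω) : g (S ω)
      = ∑ k ∈ Finset.range n, (S ⁻¹' {k}).indicator (fun _ => g k) ω := by
    rw [Finset.sum_eq_single_of_mem (S ω) (Finset.mem_range.2 (hn ω)) fun k _ hk =>
      Set.indicator_of_notMem (s := S ⁻¹' {k}) (fun h => hk h.symm) _]
    rw [Set.indicator_of_mem (show ω ∈ S ⁻¹' {S ω} from rfl)]
  rw [integral_congr_ae (ae_of_all _ hpt),
    integral_finsetSum _ fun k _ => (integrable_const _).indicator (hms k)]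
  refine Finset.sum_congr rfl fun k _ => ?_
  rw [integral_indicator_const _ (hms k), smul_eq_mul, Measure.real]

/-- **Lemma 6 (Appendix B).** If `X₁, …, X_M` are independent with `X i ∼ Bernoulli(p i)`,
then `H(∑ i, X i) ≤ (1/2) log₂(2πe (∑ i, p i + 1/12))`. -/
theorem stmt4 {Ω : Type*} [MeasurableSpace Ω] (μ : Measure Ω) [IsProbabilityMeasure μ]
    (M : ℕ) (hM : 0 < M) (p : Fin M → ℝ) (hp : ∀ i, p i ∈ Set.Icc (0 : ℝ) 1)
    (X : Fin M → Ω → ℕ) (hXmeas : ∀ i, Measurable (X i))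
    (hXval : ∀ i ω, X i ω ≤ 1)
    (hXdist : ∀ i, μ {ω | X i ω = 1} = ENNReal.ofReal (p i))
    (hindep : iIndepFun X μ) :
    shannonEntropy μ (fun ω => ∑ i, X i ω)
      ≤ (1 / 2) * Real.logb 2 (2 * Real.pi * Real.exp 1 * ((∑ i, p i) + 1 / 12)) := by
  set S : Ω → ℕ := fun ω => ∑ i, X i ω with hSdef
  have hS : Measurable S := Finset.measurable_sum _ fun i _ => hXmeas i
  have hSlt (ω : Ω) : S ω < M + 1 := by
    have : S ω ≤ ∑ _i : Fin M, 1 := Finset.sum_le_sum fun i _ => hXval i ω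
    simpa [Nat.lt_succ_iff] using this
  set q : ℕ → ℝ := fun k => (μ (S ⁻¹' {k})).toReal with hq
  have hsum : ∑ k ∈ Finset.range (M + 1), q k = 1 := by
    simpa using (integral_comp_eq_sum_range μ hS hSlt fun _ => 1).symm
  have hv : 0 < ∑ i, p i + 1 / 12 := by
    have := Finset.sum_nonneg fun i (_ : i ∈ Finset.univ) => (hp i).1
    linarith
  set Y : Fin M → Ω → ℝ := fun i ω => (X i ω : ℝ) with hY
  have hYmeas (i : Fin M) : Measurable (Y i) := measurable_from_nat.comp (hXmeas i)
  have hYmem (i : Fin M) : MemLp (Y i) 2 μ :=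
    MemLp.of_bound (hYmeas i).aestronglyMeasurable 1
      (ae_of_all _ fun ω => by simpa [hY] using hXval i ω)
  have hYmean (i : Fin M) : ∫ ω, Y i ω ∂μ = p i := by
    have h := integral_comp_eq_sum_range μ (hXmeas i) (n := 2)
      (fun ω => Nat.lt_succ_iff.2 (hXval i ω)) (fun k => (k : ℝ))
    have h1 : μ (X i ⁻¹' {1}) = ENNReal.ofReal (p i) := hXdist i
    simpa [Finset.sum_range_succ, h1, (hp i).1] using h
  have hYvar (i : Fin M) : variance (Y i) μ ≤ p i := by
    refine (variance_le_expectation_sq (hYmeas i).aestronglyMeasurable).trans_eq ?_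
    rw [← hYmean i]
    refine integral_congr_ae (ae_of_all _ fun ω => ?_)
    have := hXval i ω
    interval_cases h : X i ω <;> simp [hY, h]
  have hYsum : (∑ i, Y i) = fun ω => (S ω : ℝ) := by
    ext ω
    simp [hY, hSdef]
  have hmean : ∫ ω, (S ω : ℝ) ∂μ = ∑ i, p i := by
    rw [integral_congr_ae (ae_of_all _ fun ω => (by simp [hY, hSdef] : (S ω : ℝ) = ∑ i, Y i ω)),
      integral_finsetSum _ fun i _ => (hYmem i).integrable (by norm_num)]
    exact Finset.sum_congr rfl fun i _ => hYmean i
  have hvar : ∑ k ∈ Finset.range (M + 1), q k * ((k : ℝ) - ∑ i, p i) ^ 2 ≤ ∑ i, p i := by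
    rw [← integral_comp_eq_sum_range μ hS hSlt fun k => ((k : ℝ) - ∑ i, p i) ^ 2, ← hmean,
      ← variance_eq_integral (X := fun ω => (S ω : ℝ)) (measurable_from_nat.comp hS).aemeasurable, hmean, ← hYsum,
      IndepFun.variance_sum (fun i _ => hYmem i) fun i _ j _ hij =>
        (hindep.indepFun hij).comp measurable_from_nat measurable_from_nat]
    exact Finset.sum_le_sum fun i _ => hYvar i
  have hmain := sum_neg_mul_log_le_gaussian (M + 1) q (∑ i, p i) hv
    (fun _ => ENNReal.toReal_nonneg) hsum (by linarith)
  have hentropy : shannonEntropy μ S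
      = (∑ k ∈ Finset.range (M + 1), -(q k * Real.log (q k))) / Real.log 2 := by
    rw [shannonEntropy, tsum_eq_sum (s := Finset.range (M + 1)), Finset.sum_div]
    · refine Finset.sum_congr rfl fun k _ => ?_
      rw [Real.logb]
      ring
    · intro k hk
      have : S ⁻¹' {k} = ∅ := by
        ext ω
        have := hSlt ω
        simp only [Finset.mem_range] at hk
        simp only [Set.mem_preimage, Set.mem_singleton_iff, Set.mem_empty_iff_false, iff_false]
        omega
      simp [this]
  rw [hentropy, Real.logb, ← mul_div_assoc]
  exact div_le_div_of_nonneg_right hmain (Real.log_nonneg one_le_two)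
end

section
/- Let q ≥ 2 and M be positive integers, let S_1,…,S_M be independent random variables taking values in {0,…,q−1}, let ℓ ∈ {0,…,q−1}, and let θ be a nonnegative integer. For a partition of [1:M] into nonempty pairwise disjoint sets A_1,…,A_J with union [1:M], define U_0 = 0 and, for m ∈ [1:J], U_m = U_{m−1} + ∑_{i∈A_m} 1{U_{m−1} < θ}·1{S_i = ℓ}. Then there exists such a partition for which the joint Shannon entropy (in bits) satisfies H(U_1,…,U_J) < (5/2)·log₂(1+θ) + 12. -/
open MeasureTheory ProbabilityTheory

/-- The descriptions of the clipped frequency of the value `ℓ` (Section IV, eq. (15)):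
`U₀ = 0` and `U_m = U_{m-1} + ∑_{i ∈ A_m} 1{U_{m-1} < θ} · 1{S i = ℓ}`,
where the `m`-th group of sensors is `A m`. -/
def descr {Ω : Type*} {M : ℕ} (S : Fin M → Ω → ℕ) (ℓ θ : ℕ)
    (A : ℕ → Finset (Fin M)) : ℕ → Ω → ℕ
  | 0, _ => 0
  | m + 1, ω =>
      descr S ℓ θ A m ω +
        if descr S ℓ θ A m ω < θ then ((A (m + 1)).filter fun i => S i ω = ℓ).card else 0
/-- Gibbs' inequality: the entropy of a finitely valued random variable is at most its
cross-entropy relative to a sub-probability mass function. -/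
lemma shannonEntropy_le_integral_neg_logb {Ω α : Type*} [MeasurableSpace Ω] {μ : Measure Ω}
    [IsProbabilityMeasure μ] {X : Ω → α} (hfin : (Set.range X).Finite)
    (hX : ∀ a, MeasurableSet (X ⁻¹' {a})) {Q : α → ENNReal} (hQ : ∑' a, Q a ≤ 1)
    (hQX : ∀ ω, Q (X ω) ≠ 0) :
    shannonEntropy μ X ≤ ∫ ω, -Real.logb 2 (Q (X ω)).toReal ∂μ := by
  classical
  set F := hfin.toFinset with hF
  have hmem (ω : Ω) : X ω ∈ F := by simp [hF]
  have hQtop (a : α) : Q a ≠ ⊤ :=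
    ne_top_of_le_ne_top ENNReal.one_ne_top ((ENNReal.le_tsum a).trans hQ)
  have hQpos (a : α) (ha : a ∈ F) : 0 < (Q a).toReal := by
    obtain ⟨ω, rfl⟩ := hfin.mem_toFinset.1 ha
    exact ENNReal.toReal_pos (hQX ω) (hQtop _)
  have hQsum : ∑ a ∈ F, (Q a).toReal ≤ 1 := by
    rw [← ENNReal.toReal_sum fun a _ => hQtop a]
    exact ENNReal.toReal_mono ENNReal.one_ne_top ((ENNReal.sum_le_tsum F).trans hQ)
  have hint (g : α → ℝ) : ∫ ω, g (X ω) ∂μ = ∑ a ∈ F, μ.real (X ⁻¹' {a}) * g a := by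
    have hpt (ω : Ω) : g (X ω) = ∑ a ∈ F, (X ⁻¹' {a}).indicator (fun _ => g a) ω := by
      rw [Finset.sum_eq_single_of_mem (X ω) (hmem ω)]
      · simp
      · intro b _ hb
        simp [Set.indicator, hb.symm]
    simp_rw [hpt]
    rw [integral_finsetSum _ fun a _ => (integrable_const (g a)).indicator (hX a)]
    exact Finset.sum_congr rfl fun a _ => by rw [integral_indicator_const _ (hX a), smul_eq_mul]
  have hone : ∑ a ∈ F, μ.real (X ⁻¹' {a}) = 1 := by
    simpa using (hint fun _ => 1).symm
  rw [hint fun a => -Real.logb 2 (Q a).toReal, shannonEntropy, tsum_eq_sum (s := F)]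
  · have hlog : 0 < Real.log 2 := Real.log_pos one_lt_two
    have hterm (a : α) (ha : a ∈ F) : -(μ.real (X ⁻¹' {a}) * Real.log (μ.real (X ⁻¹' {a}))) ≤
        μ.real (X ⁻¹' {a}) * -Real.log (Q a).toReal +
          ((Q a).toReal - μ.real (X ⁻¹' {a})) := by
      rcases (measureReal_nonneg (μ := μ) (s := X ⁻¹' {a})).eq_or_lt with h0 | hpos
      · rw [← h0]; simp
      · have h := Real.log_le_sub_one_of_pos (div_pos (hQpos a ha) hpos)
        rw [Real.log_div (hQpos a ha).ne' hpos.ne'] at h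
        have h' := mul_le_mul_of_nonneg_left h hpos.le
        rw [mul_sub, mul_sub, mul_div_cancel₀ _ hpos.ne'] at h'
        linarith
    have hsum := Finset.sum_le_sum hterm
    rw [Finset.sum_add_distrib, Finset.sum_sub_distrib, hone] at hsum
    have hle : ∑ a ∈ F, -(μ.real (X ⁻¹' {a}) * Real.log (μ.real (X ⁻¹' {a}))) ≤
        ∑ a ∈ F, μ.real (X ⁻¹' {a}) * -Real.log (Q a).toReal := by linarith
    have hdiv := div_le_div_of_nonneg_right hle hlog.le
    rw [Finset.sum_div, Finset.sum_div] at hdiv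
    refine (Eq.le ?_).trans (hdiv.trans (Eq.le ?_))
    · refine Finset.sum_congr rfl fun a _ => ?_
      rw [Real.logb, ← mul_div_assoc, neg_div, measureReal_def]
    · refine Finset.sum_congr rfl fun a _ => ?_
      rw [Real.logb, mul_neg, mul_neg, neg_div, mul_div_assoc]
  · intro a ha
    have : X ⁻¹' {a} = ∅ := by
      ext ω
      simp only [Set.mem_preimage, Set.mem_singleton_iff, Set.mem_empty_iff_false, iff_false]
      rintro rfl
      exact ha (hmem ω)
    simp [this]

/-- The trajectory weights of a sub-Markov kernel on `ℕ` have total mass at most one. -/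
lemma tsum_prod_trajectory_le_one {g : ℕ → ℕ → ENNReal} (hg : ∀ x, ∑' y, g x y ≤ 1)
    (J x : ℕ) :
    ∑' u : Fin J → ℕ, ∏ m : Fin J, g ((Fin.cons x u : Fin (J + 1) → ℕ) m.castSucc) (u m)
      ≤ 1 := by
  induction J generalizing x with
  | zero => simp
  | succ J ih =>
    rw [← (Fin.consEquiv fun _ : Fin (J + 1) => ℕ).tsum_eq]
    have hterm (p : ℕ × (Fin J → ℕ)) :
        ∏ m : Fin (J + 1), g ((Fin.cons x ((Fin.consEquiv fun _ : Fin (J + 1) => ℕ) p) :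
          Fin (J + 2) → ℕ) m.castSucc) ((Fin.consEquiv fun _ : Fin (J + 1) => ℕ) p m) =
        g x p.1 * ∏ m : Fin J,
          g ((Fin.cons p.1 p.2 : Fin (J + 1) → ℕ) m.castSucc) (p.2 m) := by
      rw [Fin.prod_univ_succ]
      simp [Fin.consEquiv]
    calc _ = ∑' p : ℕ × (Fin J → ℕ), g x p.1 * ∏ m : Fin J,
          g ((Fin.cons p.1 p.2 : Fin (J + 1) → ℕ) m.castSucc) (p.2 m) := tsum_congr hterm
      _ = ∑' y, ∑' u : Fin J → ℕ, g x y * ∏ m : Fin J,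
          g ((Fin.cons y u : Fin (J + 1) → ℕ) m.castSucc) (u m) :=
        ENNReal.tsum_prod (f := fun y u => g x y * ∏ m : Fin J,
          g ((Fin.cons y u : Fin (J + 1) → ℕ) m.castSucc) (u m))
      _ ≤ ∑' y, g x y := by
        refine ENNReal.tsum_le_tsum fun y => ?_
        rw [ENNReal.tsum_mul_left]
        exact mul_le_of_le_one_right' (ih y)
      _ ≤ 1 := hg x

/-- Transition weights of a walk on `ℕ` with geometric increments of ratio `ρ`, frozen from
level `θ` on. -/
noncomputable def geometricStep (θ : ℕ) (ρ : ℝ) (x y : ℕ) : ENNReal :=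
  if x < θ then if x ≤ y then ENNReal.ofReal ((1 - ρ) * ρ ^ (y - x)) else 0
  else if y = x then 1 else 0

lemma tsum_geometricStep_le_one (θ : ℕ) {ρ : ℝ} (h0 : 0 ≤ ρ) (h1 : ρ < 1) (x : ℕ) :
    ∑' y, geometricStep θ ρ x y ≤ 1 := by
  by_cases hx : x < θ
  · have hsupp : Function.support (geometricStep θ ρ x) ⊆ Set.range (x + ·) := by
      intro y hy
      by_contra hne
      have : ¬ x ≤ y := fun h => hne ⟨y - x, by simp; omega⟩
      simp [geometricStep, hx, this] at hy
    rw [← (add_right_injective x).tsum_eq hsupp]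
    have h (k : ℕ) : geometricStep θ ρ x (x + k) = ENNReal.ofReal ((1 - ρ) * ρ ^ k) := by
      simp [geometricStep, hx]
    simp_rw [h]
    rw [← ENNReal.ofReal_tsum_of_nonneg
      (fun k => mul_nonneg (sub_nonneg.2 h1.le) (pow_nonneg h0 k))
      ((summable_geometric_of_lt_one h0 h1).mul_left _), tsum_mul_left,
      tsum_geometric_of_lt_one h0 h1, mul_inv_cancel₀ (sub_pos.2 h1).ne']
    simp
  · simp [geometricStep, hx]

/-- A finite family of weights in `[0, 1]` can be split into consecutively labelled nonempty
groups of weight at most `c + 1`, all but the last one of weight at least `c`. -/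
lemma exists_grouping {ι : Type*} [DecidableEq ι] {p : ι → ℝ} (h0 : ∀ i, 0 ≤ p i)
    (h1 : ∀ i, p i ≤ 1) {c : ℝ} (hc : 0 ≤ c) (s : Finset ι) :
    ∃ (J : ℕ) (f : ι → ℕ), (∀ i ∈ s, f i ∈ Finset.Icc 1 J) ∧
      (∀ m ∈ Finset.Icc 1 J, ∃ i ∈ s, f i = m) ∧
      (∀ m, ∑ i ∈ s with f i = m, p i ≤ c + 1) ∧
      (∀ m ∈ Finset.Ico 1 J, c ≤ ∑ i ∈ s with f i = m, p i) := by
  induction s using Finset.induction_on with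
  | empty => exact ⟨0, fun _ => 0, by simp, by simp, by simp; linarith, by simp⟩
  | insert a s ha ih =>
    obtain ⟨J, f, hf, hsurj, hup, hlow⟩ := ih
    have hsum (k m : ℕ) : ∑ i ∈ insert a s with Function.update f a k i = m, p i =
        (if k = m then p a else 0) + ∑ i ∈ s with f i = m, p i := by
      simp_rw [Finset.sum_filter]
      rw [Finset.sum_insert ha]
      simp only [Function.update_self]
      congr 1
      refine Finset.sum_congr rfl fun i hi => ?_
      rw [Function.update_of_ne (ne_of_mem_of_not_mem hi ha)]
    have hupd (k : ℕ) {i : ι} (hi : i ∈ s) : Function.update f a k i = f i :=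
      Function.update_of_ne (ne_of_mem_of_not_mem hi ha) _ _
    by_cases hJ : 0 < J ∧ ∑ i ∈ s with f i = J, p i < c
    · refine ⟨J, Function.update f a J, ?_, ?_, ?_, ?_⟩
      · intro i hi
        rcases Finset.mem_insert.1 hi with rfl | hi
        · simp; omega
        · rw [hupd _ hi]; exact hf i hi
      · intro m hm
        obtain ⟨i, hi, rfl⟩ := hsurj m hm
        exact ⟨i, Finset.mem_insert_of_mem hi, hupd _ hi⟩
      · intro m
        rw [hsum]
        split_ifs with h
        · subst h; linarith [h1 a, hJ.2]
        · linarith [hup m]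
      · intro m hm
        rw [hsum]
        have := hlow m hm
        split_ifs
        · linarith [h0 a]
        · linarith
    · refine ⟨J + 1, Function.update f a (J + 1), ?_, ?_, ?_, ?_⟩
      · intro i hi
        rcases Finset.mem_insert.1 hi with rfl | hi
        · simp
        · rw [hupd _ hi]
          have := hf i hi
          simp only [Finset.mem_Icc] at this ⊢
          omega
      · intro m hm
        by_cases h : m = J + 1
        · exact ⟨a, Finset.mem_insert_self _ _, by simp [h]⟩
        · obtain ⟨i, hi, rfl⟩ := hsurj m (by simp only [Finset.mem_Icc] at hm ⊢; omega)
          exact ⟨i, Finset.mem_insert_of_mem hi, hupd _ hi⟩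
      · intro m
        rw [hsum]
        split_ifs with h
        · have : (s.filter fun i => f i = m) = ∅ := by
            refine Finset.filter_eq_empty_iff.2 fun i hi hm => ?_
            have := Finset.mem_Icc.1 (hf i hi)
            omega
          rw [this]; simp; linarith [h1 a]
        · linarith [hup m]
      · intro m hm
        rw [hsum]
        have hm' := Finset.mem_Ico.1 hm
        rw [if_neg (by omega), zero_add]
        by_cases h : m = J
        · subst h
          by_contra hlt
          exact hJ ⟨hm'.1, not_le.1 hlt⟩
        · exact hlow m (by simp only [Finset.mem_Ico]; omega)

/-- Chernoff bound for the lower tail of a sum of independent Bernoulli variables. -/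
lemma measureReal_sum_le_le_exp {Ω ι : Type*} [MeasurableSpace Ω] {μ : Measure Ω}
    [IsProbabilityMeasure μ] {X : ι → Ω → ℝ} (hX : ∀ i, Measurable (X i))
    (h01 : ∀ i ω, X i ω = 0 ∨ X i ω = 1) (hind : iIndepFun X μ) (s : Finset ι) (t : ℝ) :
    μ.real {ω | ∑ i ∈ s, X i ω ≤ t} ≤ Real.exp (t - (∑ i ∈ s, ∫ ω, X i ω ∂μ) / 2) := by
  have hnn (i : ι) (ω : Ω) : 0 ≤ X i ω := by rcases h01 i ω with h | h <;> simp [h]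
  have hXint (i : ι) : Integrable (X i) μ :=
    Integrable.of_bound (hX i).aestronglyMeasurable 1 (ae_of_all _ fun ω => by
      rcases h01 i ω with h | h <;> simp [h])
  have hexp {Y : Ω → ℝ} (hY : Measurable Y) (hY0 : ∀ ω, 0 ≤ Y ω) :
      Integrable (fun ω => Real.exp (-1 * Y ω)) μ :=
    Integrable.of_bound (by fun_prop) 1 (ae_of_all _ fun ω => by
      simpa using hY0 ω)
  have hmgf (i : ι) : mgf (X i) μ (-1) ≤ Real.exp (-(∫ ω, X i ω ∂μ) / 2) := by
    have hpt (ω : Ω) : Real.exp (-1 * X i ω) ≤ 1 - X i ω / 2 := by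
      rcases h01 i ω with h | h
      · simp [h]
      · rw [h]
        have := Real.exp_neg_one_lt_half
        norm_num
        linarith
    calc mgf (X i) μ (-1) ≤ ∫ ω, (1 - X i ω / 2) ∂μ :=
          integral_mono (hexp (hX i) (hnn i)) ((integrable_const 1).sub ((hXint i).div_const 2))
            hpt
      _ = -(∫ ω, X i ω ∂μ) / 2 + 1 := by
          rw [integral_sub (integrable_const 1) ((hXint i).div_const 2), integral_div]
          simp; ring
      _ ≤ _ := Real.add_one_le_exp _
  have hsum0 (ω : Ω) : 0 ≤ (∑ i ∈ s, X i) ω := by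
    rw [Finset.sum_apply]; exact Finset.sum_nonneg fun i _ => hnn i ω
  have h := measure_le_le_exp_mul_mgf (X := ∑ i ∈ s, X i) (μ := μ) t
    (by norm_num : (-1 : ℝ) ≤ 0) (hexp (by fun_prop) hsum0)
  simp only [Finset.sum_apply] at h
  refine h.trans ?_
  rw [hind.mgf_sum hX, sub_eq_add_neg, Real.exp_add, neg_neg, one_mul, ← neg_div,
    ← Finset.sum_neg_distrib, Finset.sum_div, Real.exp_sum]
  gcongr with i _
  · exact fun i _ => mgf_nonneg
  · exact hmgf i

lemma measurable_descr {Ω : Type*} [MeasurableSpace Ω] {M : ℕ} {S : Fin M → Ω → ℕ}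
    (hS : ∀ i, Measurable (S i)) (ℓ θ : ℕ) (A : ℕ → Finset (Fin M)) (m : ℕ) :
    Measurable (descr S ℓ θ A m) := by
  induction m with
  | zero => exact measurable_const
  | succ m ih =>
    have hcard : Measurable fun ω => ((A (m + 1)).filter fun i => S i ω = ℓ).card := by
      simp_rw [Finset.card_filter]
      exact Finset.measurable_sum _ fun i _ =>
        Measurable.ite (hS i (measurableSet_singleton ℓ)) measurable_const measurable_const
    exact ih.add (Measurable.ite (ih measurableSet_Iio) hcard measurable_const)

/-- The clipped count is at most the unclipped one, and agrees with it below `θ`. -/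
lemma descr_le_and_eq {Ω : Type*} {M : ℕ} (S : Fin M → Ω → ℕ) (ℓ θ : ℕ) (f : Fin M → ℕ)
    (hf : ∀ i, 1 ≤ f i) (m : ℕ) (ω : Ω) :
    descr S ℓ θ (fun k => {i | f i = k}) m ω ≤
        ∑ i with f i ≤ m, (if S i ω = ℓ then 1 else 0) ∧
      (descr S ℓ θ (fun k => {i | f i = k}) m ω < θ →
        descr S ℓ θ (fun k => {i | f i = k}) m ω =
          ∑ i with f i ≤ m, (if S i ω = ℓ then 1 else 0)) := by
  induction m with
  | zero => simp [descr, fun i => Nat.one_le_iff_ne_zero.1 (hf i)]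
  | succ m ih =>
    have hsplit : ∑ i with f i ≤ m + 1, (if S i ω = ℓ then 1 else 0) =
        ∑ i with f i ≤ m, (if S i ω = ℓ then 1 else 0) +
          ((Finset.univ.filter fun i => f i = m + 1).filter fun i => S i ω = ℓ).card := by
      rw [Finset.card_filter, ← Finset.sum_union]
      · refine Finset.sum_congr ?_ fun _ _ => rfl
        ext i; simp; omega
      · refine Finset.disjoint_filter.2 fun i _ h => ?_
        omega
    simp only [descr]
    rw [hsplit]
    split_ifs with h
    · have := ih.2 h
      omega
    · have := ih.1
      omega


/-- **Lemma 1.** For independent sources `S₁, …, S_M` taking values in `{0, …, q-1}`, any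
value `ℓ` and any threshold `θ`, there exists a partition `A_1, …, A_J` of `[1:M]` into
nonempty pairwise disjoint groups such that the joint entropy of the descriptions
`U_1, …, U_J` of the clipped frequency of `ℓ` satisfies
`H(U_1, …, U_J) < (5/2) log₂(1 + θ) + 12`. -/
theorem stmt5 {Ω : Type*} [MeasurableSpace Ω] (μ : Measure Ω) [IsProbabilityMeasure μ]
    (q M : ℕ) (hq : 2 ≤ q) (hM : 0 < M)
    (S : Fin M → Ω → ℕ) (hSmeas : ∀ i, Measurable (S i)) (hSval : ∀ i ω, S i ω < q)
    (hindep : iIndepFun S μ)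
    (ℓ : ℕ) (hℓ : ℓ < q) (θ : ℕ) :
    ∃ (J : ℕ) (A : ℕ → Finset (Fin M)), 0 < J ∧
      (∀ m ∈ Finset.Icc 1 J, (A m).Nonempty) ∧
      (∀ m ∈ Finset.Icc 1 J, ∀ m' ∈ Finset.Icc 1 J, m ≠ m' → Disjoint (A m) (A m')) ∧
      ((Finset.Icc 1 J).biUnion A = Finset.univ) ∧
      shannonEntropy μ (fun ω (m : Fin J) => descr S ℓ θ A (m.1 + 1) ω)
        < (5 / 2) * Real.logb 2 (1 + (θ : ℝ)) + 12 := by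
  classical
  set E : Fin M → Set Ω := fun i => {ω | S i ω = ℓ} with hE
  have hEmeas (i : Fin M) : MeasurableSet (E i) := hSmeas i (measurableSet_singleton ℓ)
  set X : Fin M → Ω → ℝ := fun i => (fun n : ℕ => if n = ℓ then (1 : ℝ) else 0) ∘ S i with hX
  have hXind : iIndepFun X μ := hindep.comp _ fun _ => measurable_from_top
  have hXmeas (i : Fin M) : Measurable (X i) := measurable_from_top.comp (hSmeas i)
  have hX01 (i : Fin M) (ω : Ω) : X i ω = 0 ∨ X i ω = 1 := by
    by_cases h : S i ω = ℓ <;> simp [hX, h]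
  have hXint (i : Fin M) : ∫ ω, X i ω ∂μ = μ.real (E i) := by
    have : X i = (E i).indicator fun _ => 1 := by
      ext ω; simp [hX, hE, Set.indicator]
    rw [this, integral_indicator_const _ (hEmeas i), smul_eq_mul, mul_one]
  obtain ⟨J, f, hf, hsurj, hup, hlow⟩ := exists_grouping (p := fun i => μ.real (E i))
    (fun _ => measureReal_nonneg) (fun _ => measureReal_le_one)
    (by positivity : (0 : ℝ) ≤ 4 * θ) Finset.univ
  have hf1 (i : Fin M) : 1 ≤ f i := (Finset.mem_Icc.1 (hf i (Finset.mem_univ i))).1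
  have hfJ (i : Fin M) : f i ≤ J := (Finset.mem_Icc.1 (hf i (Finset.mem_univ i))).2
  set A : ℕ → Finset (Fin M) := fun k => {i | f i = k} with hA
  have hmem {i : Fin M} {k : ℕ} : i ∈ A k ↔ f i = k := by simp [hA]
  refine ⟨J, A, (hf1 ⟨0, hM⟩).trans (hfJ _), ?_, ?_, ?_, ?_⟩
  · intro m hm
    obtain ⟨i, -, hi⟩ := hsurj m hm
    exact ⟨i, hmem.2 hi⟩
  · intro m _ m' _ hne
    exact Finset.disjoint_left.2 fun i h h' => hne ((hmem.1 h).symm.trans (hmem.1 h'))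
  · ext i
    simp [hmem, hf1, hfJ]
  set T : ℕ → Finset (Fin M) := fun m => {i | f i ≤ m} with hT
  set D : ℕ → Set Ω := fun m => {ω | descr S ℓ θ A m ω < θ} with hD
  have hDmeas (m : ℕ) : MeasurableSet (D m) :=
    measurable_descr hSmeas ℓ θ A m measurableSet_Iio
  have hDT (m : ℕ) : D m = (∑ i ∈ T m, X i) ⁻¹' Set.Iio (θ : ℝ) := by
    ext ω
    obtain ⟨hle, heq⟩ := descr_le_and_eq S ℓ θ f hf1 m ω
    have hcast : (∑ i ∈ T m, X i) ω =
        ((∑ i with f i ≤ m, (if S i ω = ℓ then 1 else 0) : ℕ) : ℝ) := by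
      simp [hX, hT, Finset.sum_apply]
    simp only [hD, Set.mem_ofPred_eq, Set.mem_preimage, Set.mem_Iio, hcast, Nat.cast_lt]
    exact ⟨fun h => heq h ▸ h, fun h => hle.trans_lt h⟩
  have hDE (m : ℕ) (i : Fin M) (hi : i ∈ A (m + 1)) :
      μ.real (D m ∩ E i) = μ.real (D m) * μ.real (E i) := by
    have hnot : i ∉ T m := by simp [hT, hmem.1 hi]
    have hEX : E i = X i ⁻¹' {1} := by
      ext ω; simp [hE, hX]
    rw [hDT, hEX, measureReal_def, (hXind.indepFun_finsetSum_of_notMem hXmeas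
      hnot).measure_inter_preimage_eq_mul _ _ measurableSet_Iio (measurableSet_singleton 1),
      ENNReal.toReal_mul]
    rfl
  have hDle (m : ℕ) (hm : m < J) : μ.real (D m) ≤ (1 / 2) ^ m := by
    rcases Nat.eq_zero_or_pos θ with h0 | hθ
    · have : D m = ∅ := by ext ω; simp [hD, h0]
      rw [this]; simp
    rcases Nat.eq_zero_or_pos m with rfl | hm0
    · simp
    have hmean : m * (4 * θ : ℝ) ≤ ∑ i ∈ T m, ∫ ω, X i ω ∂μ := by
      rw [← Finset.sum_fiberwise_of_maps_to (g := f) (t := Finset.Icc 1 m)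
        (fun i hi => by simp [hf1 i, (Finset.mem_filter.1 hi).2])]
      have hcard : (m : ℝ) * (4 * θ) = ∑ _k ∈ Finset.Icc 1 m, (4 * θ : ℝ) := by simp
      rw [hcard]
      refine Finset.sum_le_sum fun k hk => ?_
      rw [Finset.mem_Icc] at hk
      refine (hlow k (by simp only [Finset.mem_Ico]; omega)).trans_eq ?_
      simp_rw [hXint]
      refine Finset.sum_congr ?_ fun _ _ => rfl
      ext i
      simp only [hT, Finset.mem_filter, Finset.mem_univ, true_and]
      omega
    have hθ1 : (1 : ℝ) ≤ θ := by exact_mod_cast hθ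
    have hm1 : (1 : ℝ) ≤ m := by exact_mod_cast hm0
    calc μ.real (D m) ≤ μ.real {ω | ∑ i ∈ T m, X i ω ≤ θ} := by
          rw [hDT]
          refine measureReal_mono fun ω hω => ?_
          simpa using (Set.mem_Iio.1 (Set.mem_preimage.1 hω)).le
      _ ≤ Real.exp (θ - (∑ i ∈ T m, ∫ ω, X i ω ∂μ) / 2) :=
          measureReal_sum_le_le_exp hXmeas hX01 hXind _ _
      _ ≤ Real.exp (m * (-1)) := Real.exp_le_exp.2 (by nlinarith)
      _ = Real.exp (-1) ^ m := Real.exp_nat_mul _ _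
      _ ≤ (1 / 2) ^ m := by
          gcongr
          exact Real.exp_neg_one_lt_half.le
  set ρ : ℝ := 1 - 1 / (4 * (1 + θ)) with hρ
  have hθ0 : (0 : ℝ) ≤ θ := Nat.cast_nonneg θ
  have hρeq : ρ = (4 * θ + 3) / (4 * (1 + θ)) := by rw [hρ]; field_simp; ring
  have hρ0 : 0 < ρ := by rw [hρeq]; positivity
  have hρ1 : 0 < 1 - ρ := by rw [hρ, sub_sub_cancel]; positivity
  set α : ℝ := -Real.logb 2 (1 - ρ) with hα
  set β : ℝ := -Real.logb 2 ρ with hβ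
  have hαeq : α = 2 + Real.logb 2 (1 + θ) := by
    rw [hα, hρ, sub_sub_cancel, one_div, Real.logb_inv, neg_neg,
      Real.logb_mul (by norm_num) (by positivity), show (4 : ℝ) = 2 ^ 2 by norm_num,
      Real.logb_pow, Real.logb_self_eq_one one_lt_two]
    norm_num
  have hβ0 : 0 ≤ β := neg_nonneg.2 (Real.logb_nonpos one_lt_two hρ0.le (by linarith))
  have hβle : β * (4 * θ + 1) ≤ 3 / 2 := by
    have hlog2 := Real.log_two_gt_d9
    have h := Real.one_sub_inv_le_log_of_pos hρ0
    have hinv : ρ⁻¹ = 1 + 1 / (4 * θ + 3) := by rw [hρeq]; field_simp; ring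
    have h' : -Real.log ρ ≤ 1 / (4 * θ + 3) := by rw [hinv] at h; linarith
    have h1 : -Real.log ρ * (4 * θ + 1) ≤ 1 := by
      calc _ ≤ 1 / (4 * θ + 3) * (4 * θ + 1 : ℝ) := by gcongr
        _ ≤ 1 := by rw [one_div_mul_eq_div, div_le_one (by positivity)]; linarith
    have h2 : β * (4 * θ + 1) = -Real.log ρ * (4 * θ + 1) / Real.log 2 := by
      rw [hβ, Real.logb]; ring
    rw [h2, div_le_iff₀ (by linarith)]
    linarith
  have hα0 : 0 ≤ α := by
    have := Real.logb_nonneg one_lt_two (by linarith : (1 : ℝ) ≤ 1 + θ)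
    linarith
  set U : Ω → Fin J → ℕ := fun ω m => descr S ℓ θ A (m.1 + 1) ω with hU
  have hcons (ω : Ω) : (Fin.cons 0 (U ω) : Fin (J + 1) → ℕ) =
      fun m => descr S ℓ θ A m.1 ω := by
    ext m
    refine Fin.cases ?_ (fun m => ?_) m
    · simp [descr]
    · simp [hU]
  set cost : ℕ → Ω → ℝ := fun m ω => (D m).indicator (fun _ => α) ω +
    ∑ i ∈ A (m + 1), (D m ∩ E i).indicator (fun _ => β) ω with hcost
  have hstep (m : ℕ) (ω : Ω) :
      geometricStep θ ρ (descr S ℓ θ A m ω) (descr S ℓ θ A (m + 1) ω) ≠ 0 ∧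
      -Real.logb 2 (geometricStep θ ρ (descr S ℓ θ A m ω)
        (descr S ℓ θ A (m + 1) ω)).toReal = cost m ω := by
    by_cases h : descr S ℓ θ A m ω < θ
    · have hpow (k : ℕ) : 0 < (1 - ρ) * ρ ^ k := mul_pos hρ1 (pow_pos hρ0 k)
      have hval : geometricStep θ ρ (descr S ℓ θ A m ω) (descr S ℓ θ A (m + 1) ω) =
          ENNReal.ofReal ((1 - ρ) * ρ ^ ((A (m + 1)).filter fun i => S i ω = ℓ).card) := by
        simp [geometricStep, descr, h]
      rw [hval]
      refine ⟨by simpa using hpow _, ?_⟩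
      rw [ENNReal.toReal_ofReal (hpow _).le, Real.logb_mul hρ1.ne' (pow_pos hρ0 _).ne',
        Real.logb_pow, Finset.card_filter]
      have hsum : ∑ i ∈ A (m + 1), (D m ∩ E i).indicator (fun _ => β) ω =
          (∑ i ∈ A (m + 1), if S i ω = ℓ then (1 : ℝ) else 0) * β := by
        rw [Finset.sum_mul]
        refine Finset.sum_congr rfl fun i _ => ?_
        simp [Set.indicator, hD, hE, h]
      simp only [hcost]
      rw [hsum, Set.indicator_of_mem (show ω ∈ D m from h)]
      push_cast
      ring
    · simp [geometricStep, descr, h, hcost, hD]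
  have hUfin : (Set.range U).Finite := by
    refine (Set.Finite.pi' fun _ : Fin J => Set.finite_Iic M).subset ?_
    rintro _ ⟨ω, rfl⟩ m
    refine (descr_le_and_eq S ℓ θ f hf1 (m.1 + 1) ω).1.trans ?_
    rw [← Finset.card_filter]
    exact (Finset.card_le_univ _).trans_eq (Fintype.card_fin M)
  have hUmeas : Measurable U :=
    measurable_pi_lambda _ fun m => measurable_descr hSmeas ℓ θ A (m.1 + 1)
  have hgibbs := shannonEntropy_le_integral_neg_logb (μ := μ) hUfin
    (fun a => hUmeas (measurableSet_singleton a))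
    (tsum_prod_trajectory_le_one (tsum_geometricStep_le_one θ hρ0.le (by linarith)) J 0)
    (fun ω => by
      rw [Finset.prod_ne_zero_iff, hcons]
      exact fun m _ => (hstep m.1 ω).1)
  have hlogQ (ω : Ω) : -Real.logb 2 (∏ m : Fin J, geometricStep θ ρ
      ((Fin.cons 0 (U ω) : Fin (J + 1) → ℕ) m.castSucc) (U ω m)).toReal =
      ∑ m : Fin J, cost m.1 ω := by
    have hfinite (m : Fin J) : (geometricStep θ ρ
        (descr S ℓ θ A m.1 ω) (descr S ℓ θ A (m.1 + 1) ω)) ≠ ⊤ := by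
      simp only [geometricStep]
      split_ifs <;> simp
    rw [hcons, ENNReal.toReal_prod]
    change -Real.logb 2 (∏ m : Fin J, (geometricStep θ ρ
      (descr S ℓ θ A m.1 ω) (descr S ℓ θ A (m.1 + 1) ω)).toReal) = _
    rw [Real.logb_prod _ _ fun m _ =>
      (ENNReal.toReal_pos (hstep m.1 ω).1 (hfinite m)).ne', ← Finset.sum_neg_distrib]
    exact Finset.sum_congr rfl fun m _ => (hstep m.1 ω).2
  simp_rw [hlogQ] at hgibbs
  have hDint (m : ℕ) : Integrable ((D m).indicator fun _ => α) μ :=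
    (integrable_const α).indicator (hDmeas m)
  have hDEint (m : ℕ) (i : Fin M) : Integrable ((D m ∩ E i).indicator fun _ => β) μ :=
    (integrable_const β).indicator ((hDmeas m).inter (hEmeas i))
  have hcostint (m : ℕ) : Integrable (cost m) μ :=
    (hDint m).add (integrable_finsetSum _ fun i _ => hDEint m i)
  have hcostle (m : Fin J) : ∫ ω, cost m.1 ω ∂μ ≤ (1 / 2) ^ m.1 * (α + 3 / 2) := by
    have heq : ∫ ω, cost m.1 ω ∂μ =
        μ.real (D m.1) * (α + β * ∑ i ∈ A (m.1 + 1), μ.real (E i)) := by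
      simp only [hcost]
      rw [integral_add (hDint m.1) (integrable_finsetSum _ fun i _ => hDEint m.1 i),
        integral_finsetSum _ fun i _ => hDEint m.1 i, integral_indicator_const _ (hDmeas m.1),
        mul_add, smul_eq_mul, Finset.mul_sum, Finset.mul_sum]
      congr 1
      refine Finset.sum_congr rfl fun i hi => ?_
      rw [integral_indicator_const _ ((hDmeas m.1).inter (hEmeas i)), hDE m.1 i hi, smul_eq_mul]
      ring
    have hgroup : β * ∑ i ∈ A (m.1 + 1), μ.real (E i) ≤ 3 / 2 :=
      (mul_le_mul_of_nonneg_left (hup (m.1 + 1)) hβ0).trans hβle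
    rw [heq]
    calc _ ≤ μ.real (D m.1) * (α + 3 / 2) := by gcongr
      _ ≤ _ := by
        gcongr
        exact hDle m.1 m.2
  have hgeom : ∑ m : Fin J, (1 / 2 : ℝ) ^ m.1 ≤ 2 := by
    rw [Fin.sum_univ_eq_sum_range fun m => (1 / 2 : ℝ) ^ m]
    exact sum_geometric_two_le J
  have hlognn := Real.logb_nonneg one_lt_two (by linarith : (1 : ℝ) ≤ 1 + θ)
  calc shannonEntropy μ U ≤ ∫ ω, ∑ m : Fin J, cost m.1 ω ∂μ := hgibbs
    _ = ∑ m : Fin J, ∫ ω, cost m.1 ω ∂μ := integral_finsetSum _ fun m _ => hcostint m.1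
    _ ≤ ∑ m : Fin J, (1 / 2) ^ m.1 * (α + 3 / 2) := Finset.sum_le_sum fun m _ => hcostle m
    _ ≤ 2 * (α + 3 / 2) := by
        rw [← Finset.sum_mul]
        gcongr
    _ < (5 / 2) * Real.logb 2 (1 + (θ : ℝ)) + 12 := by
        rw [hαeq]
        linarith
end

section
/- Let S be a finite index set, let p_i ∈ [0,1] for i ∈ S, let X_i be independent random variables with X_i ∼ Bernoulli(p_i), and let λ = ∑_{i∈S} p_i. Then for every integer j with 0 ≤ j ≤ |S|, the probability that the sum equals j satisfies P( ∑_{i∈S} X_i = j ) ≤ e^{j − λ} · λ^j / j!; that is, the Poisson-binomial point probability is at most e^j times the Poisson(λ) point probability at j. -/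
open MeasureTheory ProbabilityTheory

/-- The first two terms of the binomial expansion of `(a + b) ^ (n + 1)` bound it from below. -/
lemma pow_succ_add_mul_pow_le_add_pow {a b : ℝ} (ha : 0 ≤ a) (hb : 0 ≤ b) (n : ℕ) :
    a ^ (n + 1) + (n + 1) * b * a ^ n ≤ (a + b) ^ (n + 1) := by
  induction n with
  | zero => simp
  | succ n ih =>
    have h := mul_le_mul_of_nonneg_right ih (add_nonneg ha hb)
    have h' : 0 ≤ ((n : ℝ) + 1) * b * a ^ n * b := by positivity
    rw [pow_succ (a + b)]
    refine le_trans ?_ h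
    push_cast
    linear_combination h'

/-- The joint point probabilities of independent `ℕ`-valued variables factor. -/
lemma measureReal_inter_eq_mul {Ω : Type*} [MeasurableSpace Ω] {μ : Measure Ω}
    {S Y : Ω → ℕ} (h : IndepFun S Y μ) (m n : ℕ) :
    μ.real ({ω | S ω = m} ∩ {ω | Y ω = n}) = μ.real {ω | S ω = m} * μ.real {ω | Y ω = n} := by
  have := h.measure_inter_preimage_eq_mul {m} {n} (measurableSet_singleton m)
    (measurableSet_singleton n)
  exact (congrArg ENNReal.toReal this).trans ENNReal.toReal_mul

/-- Splitting the event `S + Y = k + 1` according to the value of a `{0, 1}`-valued `Y`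
independent of `S`. -/
lemma measureReal_add_eq_succ {Ω : Type*} [MeasurableSpace Ω] {μ : Measure Ω}
    [IsProbabilityMeasure μ] {S Y : Ω → ℕ} (hS : Measurable S) (hY : Measurable Y)
    (hY1 : ∀ ω, Y ω ≤ 1) (h : IndepFun S Y μ) (k : ℕ) :
    μ.real {ω | S ω + Y ω = k + 1} = μ.real {ω | S ω = k + 1} * μ.real {ω | Y ω = 0}
      + μ.real {ω | S ω = k} * μ.real {ω | Y ω = 1} := by
  rw [← measureReal_inter_eq_mul h, ← measureReal_inter_eq_mul h, ← measureReal_union]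
  · congr 1
    ext ω
    have := hY1 ω
    simp only [Set.mem_ofPred_eq, Set.mem_union, Set.mem_inter_iff]
    omega
  · rw [Set.disjoint_left]
    rintro ω ⟨-, h0⟩ ⟨-, h1⟩
    simp only [Set.mem_ofPred_eq] at h0 h1
    omega
  · exact (hS (measurableSet_singleton k)).inter (hY (measurableSet_singleton 1))

/-- The event `S + Y = 0` for independent `S` and `Y` with values in `ℕ`. -/
lemma measureReal_add_eq_zero {Ω : Type*} [MeasurableSpace Ω] {μ : Measure Ω}
    {S Y : Ω → ℕ} (h : IndepFun S Y μ) :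
    μ.real {ω | S ω + Y ω = 0} = μ.real {ω | S ω = 0} * μ.real {ω | Y ω = 0} := by
  rw [← measureReal_inter_eq_mul h]
  congr 1
  ext ω
  simp

/-- The pointwise Poisson bound for the sum of independent Bernoulli variables over a finset. -/
lemma measureReal_sum_bernoulli_eq_le {Ω : Type*} [MeasurableSpace Ω] {μ : Measure Ω}
    [IsProbabilityMeasure μ] {ι : Type*} {p : ι → ℝ} (hp : ∀ i, p i ∈ Set.Icc (0 : ℝ) 1)
    {X : ι → Ω → ℕ} (hX : ∀ i, Measurable (X i)) (hX1 : ∀ i ω, X i ω ≤ 1)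
    (hdist : ∀ i, μ.real {ω | X i ω = 1} = p i) (hindep : iIndepFun X μ)
    (s : Finset ι) (j : ℕ) :
    μ.real {ω | ∑ i ∈ s, X i ω = j}
      ≤ Real.exp ((j : ℝ) - ∑ i ∈ s, p i) * (∑ i ∈ s, p i) ^ j / (Nat.factorial j) := by
  classical
  induction s using Finset.induction_on generalizing j with
  | empty => cases j <;> simp
  | insert i s hi ih =>
    have hS : Measurable fun ω => ∑ i ∈ s, X i ω := Finset.measurable_fun_sum s fun i _ => hX i
    have hind : IndepFun (fun ω => ∑ i ∈ s, X i ω) (X i) μ := by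
      convert hindep.indepFun_finsetSum_of_notMem hX hi using 1
      ext ω
      simp
    have hzero : μ.real {ω | X i ω = 0} = 1 - p i := by
      have hset : {ω | X i ω = 0} = {ω | X i ω = 1}ᶜ := by
        ext ω
        have := hX1 i ω
        simp only [Set.mem_ofPred_eq, Set.mem_compl_iff]
        omega
      have hmeas : MeasurableSet {ω | X i ω = 1} := hX i (measurableSet_singleton 1)
      rw [hset, probReal_compl_eq_one_sub hmeas, hdist]
    obtain ⟨hp0, hp1⟩ := hp i
    have hsum0 : 0 ≤ ∑ i ∈ s, p i := Finset.sum_nonneg fun i _ => (hp i).1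
    have hexp : 1 - p i ≤ Real.exp (-p i) := by linarith [Real.add_one_le_exp (-p i)]
    simp only [Finset.sum_insert hi, add_comm (X i _), add_comm (p i)]
    set l := ∑ i ∈ s, p i
    cases j with
    | zero =>
      have h0 := ih 0
      rw [measureReal_add_eq_zero hind, hzero]
      simp only [Nat.cast_zero, zero_sub, pow_zero, mul_one, Nat.factorial_zero, Nat.cast_one,
        div_one] at h0 ⊢
      rw [neg_add, Real.exp_add]
      gcongr
    | succ k =>
      rw [measureReal_add_eq_succ hS (hX i) (hX1 i) hind, hzero, hdist]
      have hexp' : Real.exp ((k : ℝ) - l) ≤ Real.exp (((k + 1 : ℕ) : ℝ) - (l + p i)) := by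
        apply Real.exp_le_exp.mpr
        push_cast
        linarith
      calc _ ≤ Real.exp (((k + 1 : ℕ) : ℝ) - l) * l ^ (k + 1) / (Nat.factorial (k + 1))
              * Real.exp (-p i) + Real.exp ((k : ℝ) - l) * l ^ k / (Nat.factorial k) * p i := by
            gcongr
            · exact ih (k + 1)
            · exact ih k
        _ ≤ Real.exp (((k + 1 : ℕ) : ℝ) - (l + p i)) * l ^ (k + 1) / (Nat.factorial (k + 1))
              + Real.exp (((k + 1 : ℕ) : ℝ) - (l + p i)) * l ^ k / (Nat.factorial k) * p i := by
            have : Real.exp (((k + 1 : ℕ) : ℝ) - (l + p i))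
                = Real.exp (((k + 1 : ℕ) : ℝ) - l) * Real.exp (-p i) := by
              rw [← Real.exp_add]
              ring_nf
            refine add_le_add (le_of_eq ?_) (by gcongr)
            rw [this]
            ring
        _ = Real.exp (((k + 1 : ℕ) : ℝ) - (l + p i)) * (l ^ (k + 1) + (k + 1) * p i * l ^ k)
              / (Nat.factorial (k + 1)) := by
            rw [Nat.factorial_succ]
            push_cast
            field_simp
        _ ≤ _ := by
            gcongr
            exact pow_succ_add_mul_pow_le_add_pow hsum0 hp0 k

/-- **Poisson-binomial pointwise bound (eq. (eq:biP), Appendix B).** If `X i ∼ Bernoulli(p i)`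
are independent over a finite index set and `λ = ∑ i, p i`, then for every `0 ≤ j ≤ |S|`,
`P(∑ i, X i = j) ≤ e^{j - λ} λ^j / j!`. -/
theorem stmt9 {Ω : Type*} [MeasurableSpace Ω] (μ : Measure Ω) [IsProbabilityMeasure μ]
    {ι : Type*} [Fintype ι] (p : ι → ℝ) (hp : ∀ i, p i ∈ Set.Icc (0 : ℝ) 1)
    (X : ι → Ω → ℕ) (hXmeas : ∀ i, Measurable (X i))
    (hXval : ∀ i ω, X i ω ≤ 1)
    (hXdist : ∀ i, μ {ω | X i ω = 1} = ENNReal.ofReal (p i))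
    (hindep : iIndepFun X μ)
    (j : ℕ) (hj : j ≤ Fintype.card ι) :
    (μ {ω | (∑ i, X i ω) = j}).toReal
      ≤ Real.exp ((j : ℝ) - ∑ i, p i) * (∑ i, p i) ^ j / (Nat.factorial j) := by
  exact measureReal_sum_bernoulli_eq_le hp hXmeas hXval
    (fun i => by rw [measureReal_def, hXdist, ENNReal.toReal_ofReal (hp i).1]) hindep _ j
end

section
/- Let c ∈ (0,1), let M be a positive integer, and let X_1,…,X_M be i.i.d. Bernoulli(c) random variables. Define U_0 = 0 and U_m = U_{m−1} + 1{U_{m−1} = 0}·X_m for m ∈ [1:M]. Then the joint Shannon entropy (in bits) satisfies H(U_1,…,U_M) = ( h₂(c)/c )·( 1 − (1−c)^M ), and consequently H(U_1,…,U_M) → h₂(c)/c as M → ∞. -/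
open MeasureTheory ProbabilityTheory

/-- The binary entropy function `h₂(p) = -p log₂ p - (1-p) log₂ (1-p)`. -/
noncomputable def binEnt (p : ℝ) : ℝ :=
  -(p * Real.logb 2 p) - (1 - p) * Real.logb 2 (1 - p)

/-- The descriptions for the binary maximum under the `1`-partition (threshold `θ = 1`):
`U₀ = 0` and `U_m = U_{m-1} + 1{U_{m-1} = 0} · X_m` for `m ∈ [1:M]`. -/
def binMaxDescr {Ω : Type*} {M : ℕ} (X : Fin M → Ω → ℕ) : ℕ → Ω → ℕ
  | 0, _ => 0
  | m + 1, ω =>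
      binMaxDescr X m ω +
        if binMaxDescr X m ω = 0 then (if h : m < M then X ⟨m, h⟩ ω else 0) else 0

/-- The set of values allowed for `X i` when the first success occurs at index `t`. -/
def firstSuccessSet (t i : ℕ) : Set ℕ :=
  if i < t then {0} else if i = t then {1} else Set.univ

lemma exists_forall_mem_firstSuccessSet {M : ℕ} (x : Fin M → ℕ) (hx : ∀ i, x i ≤ 1) :
    ∃ t ≤ M, ∀ i : Fin M, x i ∈ firstSuccessSet t i := by
  classical
  have hex : ∃ t, ∀ h : t < M, x ⟨t, h⟩ = 1 := ⟨M, fun h => absurd h (lt_irrefl M)⟩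
  refine ⟨Nat.find hex, Nat.find_min' hex fun h => absurd h (lt_irrefl M), fun i => ?_⟩
  unfold firstSuccessSet
  split_ifs with hlt heq
  · have hne := Nat.find_min hex hlt
    push Not at hne
    obtain ⟨_, hne⟩ := hne
    have hle := hx i
    simp only [Fin.eta] at hne
    simp only [Set.mem_singleton_iff]
    omega
  · have hspec := Nat.find_spec hex
    simp only [← heq] at hspec
    exact hspec i.2
  · trivial

lemma binMaxDescr_eq_ite {Ω : Type*} {M : ℕ} {X : Fin M → Ω → ℕ} {ω : Ω} {t : ℕ}
    (h : ∀ i : Fin M, X i ω ∈ firstSuccessSet t i) {m : ℕ} (hm : m ≤ M) :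
    binMaxDescr X m ω = if t < m then 1 else 0 := by
  induction m with
  | zero => simp [binMaxDescr]
  | succ m ih =>
    have hmM : m < M := hm
    have hX := h ⟨m, hmM⟩
    rw [binMaxDescr, ih hmM.le, dif_pos hmM]
    rcases lt_trichotomy m t with hmt | rfl | hmt
    · have hX0 : X ⟨m, hmM⟩ ω = 0 := by simpa [firstSuccessSet, hmt] using hX
      simp [hX0, hmt.not_gt, hmt]
    · have hX1 : X ⟨m, hmM⟩ ω = 1 := by simpa [firstSuccessSet] using hX
      simp [hX1]
    · simp [hmt, hmt.trans (Nat.lt_succ_self m)]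

/-- The vector of length `M` that jumps from `0` to `1` at index `t`. -/
def stepVector (M t : ℕ) : Fin M → ℕ := fun m => if t < m.1 + 1 then 1 else 0

lemma stepVector_injOn (M : ℕ) : Set.InjOn (stepVector M) (Finset.range (M + 1)) := by
  intro s hs t ht hst
  simp only [Finset.coe_range, Set.mem_Iio] at hs ht
  by_contra hne
  rcases Nat.lt_or_gt_of_ne hne with hlt | hlt
  · have := congrFun hst ⟨s, by omega⟩
    simp [stepVector] at this
    omega
  · have := congrFun hst ⟨t, by omega⟩
    simp [stepVector] at this
    omega

lemma preimage_stepVector {Ω : Type*} {M : ℕ} {X : Fin M → Ω → ℕ}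
    (hX : ∀ i ω, X i ω ≤ 1) {t : ℕ} (ht : t ≤ M) :
    (fun ω (m : Fin M) => binMaxDescr X (m.1 + 1) ω) ⁻¹' {stepVector M t} =
      ⋂ i ∈ (Finset.univ : Finset (Fin M)), X i ⁻¹' firstSuccessSet t i := by
  ext ω
  simp only [Set.mem_preimage, Set.mem_singleton_iff, Finset.mem_univ, Set.iInter_true,
    Set.mem_iInter]
  constructor
  · intro hω
    obtain ⟨s, hs, hmem⟩ := exists_forall_mem_firstSuccessSet (fun i => X i ω) (hX · ω)
    have hstep : stepVector M s = stepVector M t := by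
      rw [← hω]
      exact funext fun m => (binMaxDescr_eq_ite hmem m.2).symm
    rwa [← stepVector_injOn M (by simpa [Nat.lt_succ_iff] using hs)
      (by simpa [Nat.lt_succ_iff] using ht) hstep]
  · exact fun h => funext fun m => binMaxDescr_eq_ite h m.2

lemma prod_range_first_success (c : ℝ) (t n : ℕ) :
    ∏ i ∈ Finset.range n, (if i < t then 1 - c else if i = t then c else 1) =
      if n ≤ t then (1 - c) ^ n else c * (1 - c) ^ t := by
  induction n with
  | zero => simp
  | succ n ih =>
    rw [Finset.prod_range_succ, ih]
    rcases lt_trichotomy n t with h | rfl | h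
    · simp [h, h.le, pow_succ]
    · simp [mul_comm]
    · simp [h.not_ge, h.not_gt, h.ne', (h.trans (Nat.lt_succ_self n)).not_ge]

lemma toReal_measure_preimage_firstSuccessSet {Ω : Type*} [MeasurableSpace Ω] {μ : Measure Ω}
    [IsProbabilityMeasure μ] {c : ℝ} (hc : 0 ≤ c) {Y : Ω → ℕ} (hY : Measurable Y)
    (hYval : ∀ ω, Y ω ≤ 1) (hYdist : μ {ω | Y ω = 1} = ENNReal.ofReal c) (t i : ℕ) :
    (μ (Y ⁻¹' firstSuccessSet t i)).toReal =
      if i < t then 1 - c else if i = t then c else 1 := by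
  have hone : μ.real (Y ⁻¹' {1}) = c := by
    change (μ {ω | Y ω = 1}).toReal = c
    rw [hYdist, ENNReal.toReal_ofReal hc]
  have hzero : Y ⁻¹' {0} = (Y ⁻¹' {1})ᶜ := by
    ext ω
    have := hYval ω
    simp only [Set.mem_preimage, Set.mem_singleton_iff, Set.mem_compl_iff]
    omega
  change μ.real _ = _
  unfold firstSuccessSet
  split_ifs
  · rw [hzero, probReal_compl_eq_one_sub (hY (measurableSet_singleton 1)), hone]
  · exact hone
  · simp

lemma toReal_measure_preimage_stepVector {Ω : Type*} [MeasurableSpace Ω] {μ : Measure Ω}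
    [IsProbabilityMeasure μ] {c : ℝ} (hc : 0 ≤ c) {M : ℕ} {X : Fin M → Ω → ℕ}
    (hXmeas : ∀ i, Measurable (X i)) (hXval : ∀ i ω, X i ω ≤ 1)
    (hXdist : ∀ i, μ {ω | X i ω = 1} = ENNReal.ofReal c) (hindep : iIndepFun X μ)
    {t : ℕ} (ht : t ≤ M) :
    (μ ((fun ω (m : Fin M) => binMaxDescr X (m.1 + 1) ω) ⁻¹' {stepVector M t})).toReal =
      if M ≤ t then (1 - c) ^ M else c * (1 - c) ^ t := by
  rw [preimage_stepVector hXval ht,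
    hindep.measure_inter_preimage_eq_mul Finset.univ fun _ _ => MeasurableSet.of_discrete,
    ENNReal.toReal_prod, ← prod_range_first_success, ← Fin.prod_univ_eq_prod_range]
  exact Finset.prod_congr rfl fun i _ =>
    toReal_measure_preimage_firstSuccessSet hc (hXmeas i) (hXval i) (hXdist i) t i

/-- Entropy of a geometric distribution truncated at `M`. -/
lemma truncated_geometric_entropy {c : ℝ} (hc : c ∈ Set.Ioo (0 : ℝ) 1) (M : ℕ) :
    ∑ t ∈ Finset.range M, -(c * (1 - c) ^ t * Real.logb 2 (c * (1 - c) ^ t)) +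
      -((1 - c) ^ M * Real.logb 2 ((1 - c) ^ M)) = binEnt c / c * (1 - (1 - c) ^ M) := by
  have hc0 : c ≠ 0 := hc.1.ne'
  have hq0 : 1 - c ≠ 0 := (sub_pos.2 hc.2).ne'
  have hlog (t : ℕ) : Real.logb 2 (c * (1 - c) ^ t) =
      Real.logb 2 c + t * Real.logb 2 (1 - c) := by
    rw [Real.logb_mul hc0 (pow_ne_zero t hq0), Real.logb_pow]
  simp only [hlog, Real.logb_pow]
  induction M with
  | zero => simp
  | succ M ih =>
    have hstep : binEnt c / c * (1 - (1 - c) ^ (M + 1)) =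
        binEnt c / c * (1 - (1 - c) ^ M) + (1 - c) ^ M * binEnt c := by
      field_simp
      ring
    rw [Finset.sum_range_succ, hstep, ← ih, binEnt]
    push_cast
    ring

/-- **Binary maximum example (Section IV-A), i.i.d. Bernoulli(c) ensemble, 1-partition.**
`H(U_1, …, U_M) = (h₂(c)/c) (1 - (1-c)^M)`, and consequently this quantity tends to
`h₂(c)/c` as `M → ∞`. -/
theorem stmt12 {Ω : Type*} [MeasurableSpace Ω] (μ : Measure Ω) [IsProbabilityMeasure μ]
    (c : ℝ) (hc : c ∈ Set.Ioo (0 : ℝ) 1) (M : ℕ) (hM : 0 < M)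
    (X : Fin M → Ω → ℕ) (hXmeas : ∀ i, Measurable (X i))
    (hXval : ∀ i ω, X i ω ≤ 1)
    (hXdist : ∀ i, μ {ω | X i ω = 1} = ENNReal.ofReal c)
    (hindep : iIndepFun X μ) :
    shannonEntropy μ (fun ω (m : Fin M) => binMaxDescr X (m.1 + 1) ω)
        = (binEnt c / c) * (1 - (1 - c) ^ M) ∧
      Filter.Tendsto (fun M' : ℕ => (binEnt c / c) * (1 - (1 - c) ^ M'))
        Filter.atTop (nhds (binEnt c / c)) := by
  refine ⟨?_, ?_⟩
  · classical
    have hmeasure {t : ℕ} (ht : t ≤ M) :=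
      toReal_measure_preimage_stepVector hc.1.le hXmeas hXval hXdist hindep ht
    rw [← truncated_geometric_entropy hc M, shannonEntropy,
      tsum_eq_sum (s := (Finset.range (M + 1)).image (stepVector M)),
      Finset.sum_image (stepVector_injOn M), Finset.sum_range_succ]
    · congr 1
      · refine Finset.sum_congr rfl fun t ht => ?_
        have htM := Finset.mem_range.1 ht
        rw [hmeasure htM.le, if_neg htM.not_ge]
      · rw [hmeasure le_rfl, if_pos le_rfl]
    · intro a ha
      have hempty : (fun ω (m : Fin M) => binMaxDescr X (m.1 + 1) ω) ⁻¹' {a} = ∅ := by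
        refine Set.eq_empty_of_forall_notMem fun ω hω => ha ?_
        obtain ⟨t, ht, hmem⟩ := exists_forall_mem_firstSuccessSet (fun i => X i ω) (hXval · ω)
        refine Finset.mem_image.2 ⟨t, Finset.mem_range.2 (Nat.lt_succ_of_le ht), ?_⟩
        rw [← Set.mem_singleton_iff.1 hω]
        exact funext fun m => (binMaxDescr_eq_ite hmem m.2).symm
      simp [hempty]
  · have hpow := tendsto_pow_atTop_nhds_zero_of_lt_one (sub_nonneg.2 hc.2.le)
      (sub_lt_self 1 hc.1)
    simpa using (hpow.const_sub 1).const_mul (binEnt c / c)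
end

section
/- Let q ≥ 2 and M be positive integers, let S_1,…,S_M be independent random variables taking values in {0,…,q−1}, let ℓ ∈ {0,…,q−1}, and let θ ≥ 1 be an integer. Let A_1,…,A_J be a partition of [1:M] into nonempty pairwise disjoint sets with union [1:M], define U_0 = 0 and U_m = U_{m−1} + ∑_{i∈A_m} 1{U_{m−1} < θ}·1{S_i = ℓ} for m ∈ [1:J], and let B_m = ∑_{i∈A_m} 1{S_i = ℓ} denote the m-th block count. Then the joint Shannon entropy (in bits) satisfies H(U_1,…,U_J) = H(B_1) + ∑_{m=2}^{J} P(U_{m−1} < θ)·H(B_m). -/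
open MeasureTheory ProbabilityTheory

lemma shannonEntropy_eq_sum {Ω α : Type*} [MeasurableSpace Ω] (μ : Measure Ω) (X : Ω → α)
    (s : Finset α) (hs : ∀ ω, X ω ∈ s) :
    shannonEntropy μ X
      = ∑ a ∈ s, -(μ.real (X ⁻¹' {a}) * Real.logb 2 (μ.real (X ⁻¹' {a}))) := by
  refine tsum_eq_sum fun a ha => ?_
  have h : X ⁻¹' {a} = ∅ := by
    ext ω
    simp only [Set.mem_preimage, Set.mem_singleton_iff, Set.mem_empty_iff_false, iff_false]
    rintro rfl
    exact ha (hs ω)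
  simp [h]

lemma shannonEntropy_comp_of_injective {Ω α β : Type*} [MeasurableSpace Ω] (μ : Measure Ω)
    (X : Ω → α) {f : α → β} (hf : Function.Injective f) :
    shannonEntropy μ (fun ω => f (X ω)) = shannonEntropy μ X := by
  have hpre : ∀ a, (fun ω => f (X ω)) ⁻¹' {f a} = X ⁻¹' {a} := fun a => by
    ext ω
    simp [hf.eq_iff]
  unfold shannonEntropy
  rw [← hf.tsum_eq]
  · simp only [hpre]
  · intro b hb
    by_contra hbr
    have h : (fun ω => f (X ω)) ⁻¹' {b} = ∅ := by
      ext ω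
      simp only [Set.mem_preimage, Set.mem_singleton_iff, Set.mem_empty_iff_false, iff_false]
      exact fun h => hbr ⟨_, h⟩
    simp [h] at hb

lemma sum_measureReal_preimage_singleton_filter {Ω α : Type*} [MeasurableSpace Ω]
    [MeasurableSpace α] [MeasurableSingletonClass α] (μ : Measure Ω) [IsFiniteMeasure μ]
    {X : Ω → α} (hX : Measurable X) (s : Finset α) (hs : ∀ ω, X ω ∈ s)
    (p : α → Prop) [DecidablePred p] :
    ∑ a ∈ s with p a, μ.real (X ⁻¹' {a}) = μ.real {ω | p (X ω)} := by
  rw [sum_measureReal_preimage_singleton _ fun a _ => hX (measurableSet_singleton a)]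
  congr 1
  ext ω
  simp [hs ω]

/-- Chain rule for `(X, V)` where `V` equals `B` on the event `p X` and `0` off it, with `B`
independent of `X`. -/
lemma shannonEntropy_prod_ite {Ω α : Type*} [MeasurableSpace Ω]
    [MeasurableSpace α] [MeasurableSingletonClass α] (μ : Measure Ω) [IsProbabilityMeasure μ]
    {X : Ω → α} {B : Ω → ℕ} (hX : Measurable X) (hB : Measurable B) (hXB : IndepFun X B μ)
    (s : Finset α) (hs : ∀ ω, X ω ∈ s) (N : ℕ) (hN : ∀ ω, B ω < N)
    (p : α → Prop) [DecidablePred p] :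
    shannonEntropy μ (fun ω => (X ω, if p (X ω) then B ω else 0))
      = shannonEntropy μ X + μ.real {ω | p (X ω)} * shannonEntropy μ B := by
  have hNmem : ∀ ω, B ω ∈ Finset.range N := fun ω => Finset.mem_range.2 (hN ω)
  have hsumB : ∑ b ∈ Finset.range N, μ.real (B ⁻¹' {b}) = 1 := by
    simpa using sum_measureReal_preimage_singleton_filter μ hB _ hNmem fun _ => True
  have hpos : ∀ ω, 0 < N := fun ω => (Nat.zero_le _).trans_lt (hN ω)
  rw [shannonEntropy_eq_sum μ _ (s ×ˢ Finset.range N), Finset.sum_product,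
    shannonEntropy_eq_sum μ X s hs, ← sum_measureReal_preimage_singleton_filter μ hX s hs p,
    Finset.sum_filter, Finset.sum_mul, ← Finset.sum_add_distrib]
  swap
  · intro ω
    have := hN ω
    simp only [Finset.mem_product, hs ω, Finset.mem_range, true_and]
    split_ifs <;> omega
  refine Finset.sum_congr rfl fun a _ => ?_
  by_cases hpa : p a
  · have hpre : ∀ b, μ.real ((fun ω => (X ω, if p (X ω) then B ω else 0)) ⁻¹' {(a, b)})
        = μ.real (X ⁻¹' {a}) * μ.real (B ⁻¹' {b}) := fun b => by
      have : (fun ω => (X ω, if p (X ω) then B ω else 0)) ⁻¹' {(a, b)}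
          = X ⁻¹' {a} ∩ B ⁻¹' {b} := by
        ext ω
        simp only [Set.mem_preimage, Set.mem_singleton_iff, Prod.mk.injEq, Set.mem_inter_iff]
        refine and_congr_right fun h => ?_
        simp [h, hpa]
      rw [this, measureReal_def, hXB.measure_inter_preimage_eq_mul _ _
        (measurableSet_singleton a) (measurableSet_singleton b), ENNReal.toReal_mul]
      rfl
    simp only [hpre, hpa, if_true]
    rw [shannonEntropy_eq_sum μ B _ hNmem, Finset.mul_sum]
    have hmul : ∀ x y : ℝ, -(x * y * Real.logb 2 (x * y))
        = y * -(x * Real.logb 2 x) + x * -(y * Real.logb 2 y) := fun x y => by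
      rcases eq_or_ne x 0 with rfl | hx
      · simp
      rcases eq_or_ne y 0 with rfl | hy
      · simp
      rw [Real.logb_mul hx hy]
      ring
    simp only [hmul]
    rw [Finset.sum_add_distrib, ← Finset.sum_mul, hsumB, one_mul]
  · have hpre : ∀ b, (fun ω => (X ω, if p (X ω) then B ω else 0)) ⁻¹' {(a, b)}
        = if b = 0 then X ⁻¹' {a} else ∅ := fun b => by
      ext ω
      by_cases hb : b = 0
      · simp only [Set.mem_preimage, Set.mem_singleton_iff, Prod.mk.injEq, hb, if_true]
        exact ⟨And.left, fun h => ⟨h, by simp [h, hpa]⟩⟩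
      · simp only [Set.mem_preimage, Set.mem_singleton_iff, Prod.mk.injEq, hb, if_false,
          Set.mem_empty_iff_false, iff_false, not_and]
        rintro rfl
        simp [hpa, Ne.symm hb]
    simp only [hpre, hpa, if_false, zero_mul, add_zero]
    obtain ⟨ω⟩ := nonempty_of_isProbabilityMeasure μ
    rw [Finset.sum_eq_single 0 (fun b _ hb => by simp [hb])
      fun h => absurd (Finset.mem_range.2 (hpos ω)) h]
    simp

lemma descr_congr {Ω Ω' : Type*} {M : ℕ} {S : Fin M → Ω → ℕ} {S' : Fin M → Ω' → ℕ} (ℓ θ : ℕ)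
    {A : ℕ → Finset (Fin M)} {ω : Ω} {ω' : Ω'} (k : ℕ)
    (h : ∀ i ∈ (Finset.Icc 1 k).biUnion A, S i ω = S' i ω') :
    descr S ℓ θ A k ω = descr S' ℓ θ A k ω' := by
  induction k with
  | zero => rfl
  | succ k ih =>
    have hk : descr S ℓ θ A k ω = descr S' ℓ θ A k ω' := ih fun i hi => h i <|
      Finset.biUnion_subset_biUnion_of_subset_left A
        (Finset.Icc_subset_Icc_right k.le_succ) hi
    have hA : (A (k + 1)).filter (fun i => S i ω = ℓ)
        = (A (k + 1)).filter fun i => S' i ω' = ℓ :=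
      Finset.filter_congr fun i hi => by
        rw [h i (Finset.mem_biUnion.2 ⟨k + 1, by simp, hi⟩)]
    simp only [descr, hk, hA]

lemma descr_le {Ω : Type*} {M : ℕ} (S : Fin M → Ω → ℕ) (ℓ θ : ℕ)
    (A : ℕ → Finset (Fin M)) (k : ℕ) (ω : Ω) : descr S ℓ θ A k ω ≤ k * M := by
  induction k with
  | zero => simp [descr]
  | succ k ih =>
    have hcard : ((A (k + 1)).filter fun i => S i ω = ℓ).card ≤ M := by
      simpa using Finset.card_le_univ ((A (k + 1)).filter fun i => S i ω = ℓ)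
    rw [descr, Nat.succ_mul]
    split_ifs <;> omega

/-- The first `k` descriptions are a function of the sources in the first `k` blocks. -/
lemma exists_descr_eq_comp {Ω : Type*} {M : ℕ} (S : Fin M → Ω → ℕ) (ℓ θ : ℕ)
    (A : ℕ → Finset (Fin M)) (k : ℕ) :
    ∃ φ : (((Finset.Icc 1 k).biUnion A : Finset (Fin M)) → ℕ) → Fin k → ℕ,
      (fun ω (m : Fin k) => descr S ℓ θ A (m.1 + 1) ω) = φ ∘ fun ω i => S i ω := by
  refine ⟨fun s m => descr (fun i s => if h : i ∈ (Finset.Icc 1 k).biUnion A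
    then s ⟨i, h⟩ else 0) ℓ θ A (m.1 + 1) s, ?_⟩
  funext ω m
  refine descr_congr ℓ θ _ fun i hi => ?_
  have hi' : i ∈ (Finset.Icc 1 k).biUnion A :=
    Finset.biUnion_subset_biUnion_of_subset_left A (Finset.Icc_subset_Icc_right m.2) hi
  simp only [hi', dite_true]

/-- The number of sources in a block equal to `ℓ` is a function of the sources in the block. -/
lemma exists_card_filter_eq_comp {Ω : Type*} {M : ℕ} (S : Fin M → Ω → ℕ) (ℓ : ℕ)
    (T : Finset (Fin M)) :
    ∃ ψ : (T → ℕ) → ℕ,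
      (fun ω => (T.filter fun i => S i ω = ℓ).card) = ψ ∘ fun ω i => S i ω := by
  refine ⟨fun s => (T.filter fun i => (if h : i ∈ T then s ⟨i, h⟩ else 0) = ℓ).card, ?_⟩
  funext ω
  refine congrArg Finset.card (Finset.filter_congr fun i hi => ?_)
  simp only [hi, dite_true]

lemma shannonEntropy_descr_succ {Ω : Type*} [MeasurableSpace Ω] (μ : Measure Ω)
    [IsProbabilityMeasure μ] {M : ℕ} {S : Fin M → Ω → ℕ} (hSmeas : ∀ i, Measurable (S i))
    (hindep : iIndepFun S μ) (ℓ θ : ℕ) (A : ℕ → Finset (Fin M)) (k : ℕ)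
    (hdisj : Disjoint ((Finset.Icc 1 k).biUnion A) (A (k + 1))) :
    shannonEntropy μ (fun ω (m : Fin (k + 1)) => descr S ℓ θ A (m.1 + 1) ω)
      = shannonEntropy μ (fun ω (m : Fin k) => descr S ℓ θ A (m.1 + 1) ω) +
        μ.real {ω | descr S ℓ θ A k ω < θ} *
          shannonEntropy μ (fun ω => ((A (k + 1)).filter fun i => S i ω = ℓ).card) := by
  set X : Ω → Fin k → ℕ := fun ω m => descr S ℓ θ A (m.1 + 1) ω with hXdef
  set B : Ω → ℕ := fun ω => ((A (k + 1)).filter fun i => S i ω = ℓ).card with hBdef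
  obtain ⟨φ, hφ⟩ := exists_descr_eq_comp S ℓ θ A k
  obtain ⟨ψ, hψ⟩ := exists_card_filter_eq_comp S ℓ (A (k + 1))
  have hX : Measurable X := by
    rw [hXdef, hφ]
    exact (Measurable.of_discrete (f := φ)).comp (measurable_pi_lambda _ fun i => hSmeas i)
  have hB : Measurable B := by
    rw [hBdef, hψ]
    exact (Measurable.of_discrete (f := ψ)).comp (measurable_pi_lambda _ fun i => hSmeas i)
  have hXB : IndepFun X B μ := by
    rw [hXdef, hBdef, hφ, hψ]
    exact (hindep.indepFun_finset _ _ hdisj hSmeas).comp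
      Measurable.of_discrete Measurable.of_discrete
  obtain ⟨g, hg⟩ : ∃ g : (Fin k → ℕ) → ℕ, ∀ ω, descr S ℓ θ A k ω = g (X ω) := by
    rcases k with _ | k
    · exact ⟨fun _ => 0, fun _ => rfl⟩
    · exact ⟨fun x => x (Fin.last k), fun _ => rfl⟩
  have hs : ∀ ω, X ω ∈ Fintype.piFinset fun _ : Fin k => Finset.range (k * M + 1) := fun ω => by
    refine Fintype.mem_piFinset.2 fun m => Finset.mem_range.2 (Nat.lt_succ_of_le ?_)
    exact (descr_le S ℓ θ A _ ω).trans (Nat.mul_le_mul_right M m.2)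
  have hN : ∀ ω, B ω < M + 1 := fun ω => Nat.lt_succ_of_le <| by
    simpa using Finset.card_le_univ ((A (k + 1)).filter fun i => S i ω = ℓ)
  have hf : Function.Injective fun x : (Fin k → ℕ) × ℕ =>
      (Fin.snoc x.1 (g x.1 + x.2) : Fin (k + 1) → ℕ) := by
    rintro ⟨x, b⟩ ⟨y, c⟩ h
    obtain ⟨rfl, h⟩ := Fin.snoc_injective2 h
    simpa using h
  have hsnoc : (fun ω (m : Fin (k + 1)) => descr S ℓ θ A (m.1 + 1) ω)
      = fun ω => (fun x : (Fin k → ℕ) × ℕ => (Fin.snoc x.1 (g x.1 + x.2) : Fin (k + 1) → ℕ))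
        (X ω, if g (X ω) < θ then B ω else 0) := by
    funext ω m
    refine Fin.lastCases ?_ (fun m => ?_) m
    · simp only [Fin.snoc_last, Fin.val_last, descr, hg, hBdef]
    · simp only [Fin.snoc_castSucc, Fin.val_castSucc, hXdef]
  rw [hsnoc, shannonEntropy_comp_of_injective μ _ hf,
    shannonEntropy_prod_ite μ hX hB hXB _ hs _ hN fun x => g x < θ]
  simp only [hg]

lemma shannonEntropy_descr {Ω : Type*} [MeasurableSpace Ω] (μ : Measure Ω)
    [IsProbabilityMeasure μ] {M : ℕ} {S : Fin M → Ω → ℕ} (hSmeas : ∀ i, Measurable (S i))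
    (hindep : iIndepFun S μ) (ℓ θ : ℕ) (A : ℕ → Finset (Fin M)) (J : ℕ)
    (hdisj : ∀ m ∈ Finset.Icc 1 J, ∀ m' ∈ Finset.Icc 1 J, m ≠ m' → Disjoint (A m) (A m')) :
    shannonEntropy μ (fun ω (m : Fin J) => descr S ℓ θ A (m.1 + 1) ω)
      = ∑ m ∈ Finset.Icc 1 J, μ.real {ω | descr S ℓ θ A (m - 1) ω < θ} *
          shannonEntropy μ (fun ω => ((A m).filter fun i => S i ω = ℓ).card) := by
  induction J with
  | zero =>
    rw [shannonEntropy_eq_sum μ _ Finset.univ fun _ => Finset.mem_univ _]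
    have hpre : ∀ a : Fin 0 → ℕ,
        (fun ω (m : Fin 0) => descr S ℓ θ A (m.1 + 1) ω) ⁻¹' {a} = Set.univ := fun a =>
      Set.eq_univ_of_forall fun _ => Subsingleton.elim _ a
    simp [hpre]
  | succ k ih =>
    have hsub : Finset.Icc 1 k ⊆ Finset.Icc 1 (k + 1) := Finset.Icc_subset_Icc_right k.le_succ
    rw [shannonEntropy_descr_succ μ hSmeas hindep, Finset.sum_Icc_succ_top (by omega),
      ih fun m hm m' hm' => hdisj m (hsub hm) m' (hsub hm'), Nat.add_sub_cancel]
    refine (Finset.disjoint_biUnion_left _ _ _).2 fun m hm => ?_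
    exact hdisj m (hsub hm) (k + 1) (by simp) (by have := (Finset.mem_Icc.1 hm).2; omega)

/-- **Entropy identity (eq:HU1 / eq:HUbound).** For independent sources and a partition
`A_1, …, A_J` of `[1:M]`, with block counts `B_m = ∑_{i ∈ A_m} 1{S i = ℓ}`,
`H(U_1, …, U_J) = H(B_1) + ∑_{m=2}^{J} P(U_{m-1} < θ) · H(B_m)`. -/
theorem stmt15 {Ω : Type*} [MeasurableSpace Ω] (μ : Measure Ω) [IsProbabilityMeasure μ]
    (q M : ℕ) (hq : 2 ≤ q) (hM : 0 < M)
    (S : Fin M → Ω → ℕ) (hSmeas : ∀ i, Measurable (S i)) (hSval : ∀ i ω, S i ω < q)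
    (hindep : iIndepFun S μ)
    (ℓ : ℕ) (hℓ : ℓ < q) (θ : ℕ) (hθ : 1 ≤ θ)
    (J : ℕ) (hJ : 0 < J) (A : ℕ → Finset (Fin M))
    (hne : ∀ m ∈ Finset.Icc 1 J, (A m).Nonempty)
    (hdisj : ∀ m ∈ Finset.Icc 1 J, ∀ m' ∈ Finset.Icc 1 J, m ≠ m' → Disjoint (A m) (A m'))
    (hcover : (Finset.Icc 1 J).biUnion A = Finset.univ) :
    shannonEntropy μ (fun ω (m : Fin J) => descr S ℓ θ A (m.1 + 1) ω)
      = shannonEntropy μ (fun ω => ((A 1).filter fun i => S i ω = ℓ).card) +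
        ∑ m ∈ Finset.Icc 2 J,
          (μ {ω | descr S ℓ θ A (m - 1) ω < θ}).toReal *
            shannonEntropy μ (fun ω => ((A m).filter fun i => S i ω = ℓ).card) := by
  rw [shannonEntropy_descr μ hSmeas hindep ℓ θ A J hdisj,
    ← Finset.insert_Icc_add_one_left_eq_Icc (show 1 ≤ J from hJ),
    Finset.sum_insert (by simp)]
  have hstart : {ω | descr S ℓ θ A (1 - 1) ω < θ} = Set.univ :=
    Set.eq_univ_of_forall fun _ => hθ
  rw [hstart, probReal_univ, one_mul]
  rfl
end
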